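/- arXiv:1612.03540 — 2 statements merged into one kernel-verified Lean document; each statement's English description precedes it below -/
import Mathlib

section
/- Let D ⊆ ℝ² be homeomorphic to the closed unit disk, and let K ⊆ D be a compact connected set with K ∩ ∂D = ∅. Then D \ K has exactly one connected component whose closure meets ∂D, and any two points of D \ K lying in that component can be joined by a path in D \ K; moreover if additionally K is the image of an arc with both probe points x, x' ∈ D \ K given, and K separates neither from ∂D, then x and x' lie in the same path component of D \ K. -/
open Set

lemma aux_convex_log (V : Set ℂ) (hV : Convex ℝ V) (hne : V.Nonempty) (f : V → ℂ)
    (hf : Continuous f) (h0 : ∀ v, f v ≠ 0) :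
    ∃ l : V → ℂ, Continuous l ∧ ∀ v, Complex.exp (l v) = f v := by
  have : ContractibleSpace V := hV.contractibleSpace hne
  have : LocallyPathConnectedSpace V := hV.locallyPathConnectedSpace
  obtain ⟨x₀, hx₀⟩ := hne
  obtain ⟨F, ⟨-, hF⟩, -⟩ := Complex.isCoveringMapOn_exp.existsUnique_continuousMap_lifts
    (⟨f, hf⟩ : C(V, ℂ)) (a₀ := ⟨x₀, hx₀⟩) (Complex.exp_log (h0 ⟨x₀, hx₀⟩)) (fun v => h0 v)
  exact ⟨F, F.continuous, fun v => congrFun hF v⟩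

lemma aux_no_log (a : ℂ) (s : ℝ) (hs : 0 < s) (L : ℂ → ℂ)
    (hL : ContinuousOn L (Metric.sphere a s))
    (he : ∀ z ∈ Metric.sphere a s, Complex.exp (L z) = z - a) : False := by
  let g₁ : ℝ → ℂ := fun t => L (circleMap a s t)
  let g₂ : ℝ → ℂ := fun t => L (circleMap a s 0) + t * Complex.I
  have h₁ : Continuous g₁ :=
    hL.comp_continuous (continuous_circleMap a s) (fun t => circleMap_mem_sphere a hs.le t)
  have h₂ : Continuous g₂ := by fun_prop
  have key : g₁ = g₂ := by
    refine Complex.isCoveringMap_exp.eq_of_comp_eq h₁ h₂ ?_ 0 (by simp [g₁, g₂])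
    funext t
    apply Subtype.ext
    simp only [Function.comp, g₁, g₂]
    rw [Complex.exp_add, he _ (circleMap_mem_sphere a hs.le t),
      he _ (circleMap_mem_sphere a hs.le 0)]
    simp [circleMap]
  have := congrFun key (2 * Real.pi)
  simp only [g₁, g₂] at this
  rw [show circleMap a s (2 * Real.pi) = circleMap a s 0 by simp [circleMap]] at this
  simp [Real.pi_ne_zero] at this

/-- Boundary points of the disk go to boundary points. -/
lemma aux_sphere (D : Set ℂ) (h : (Metric.closedBall (0:ℂ) 1) ≃ₜ D)
    (c : Metric.closedBall (0:ℂ) 1) (hc : ‖(c : ℂ)‖ = 1) : (h c : ℂ) ∉ interior D := by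
  intro hint
  set p : ℂ := (h c : ℂ) with hp
  obtain ⟨r, hr, hrD⟩ := Metric.isOpen_iff.1 isOpen_interior p hint
  let V : Set ℂ := Metric.closedBall 0 1 \ {(c : ℂ)}
  have hVB : ∀ v : V, (v : ℂ) ∈ Metric.closedBall (0:ℂ) 1 := fun v => v.2.1
  have hV : Convex ℝ V := by
    rw [convex_iff_forall_pos]
    intro x hx y hy α β hα hβ hαβ
    refine ⟨convex_closedBall _ _ hx.1 hy.1 hα.le hβ.le hαβ, fun hh => ?_⟩
    rw [mem_singleton_iff] at hh
    by_cases hxy : x = y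
    · subst hxy
      rw [← add_smul, hαβ, one_smul] at hh
      exact hx.2 hh
    · have h1 := strictConvex_closedBall ℝ (0:ℂ) 1 hx.1 hy.1 hxy hα hβ hαβ
      rw [hh, interior_closedBall _ one_ne_zero, mem_ball_zero_iff] at h1
      linarith
  have hne : V.Nonempty := ⟨0, by simp, by
    intro h0; rw [mem_singleton_iff] at h0; rw [← h0] at hc; simp at hc⟩
  obtain ⟨l, hl, hle⟩ := aux_convex_log V hV hne (fun v => (h ⟨v, hVB v⟩ : ℂ) - p)
    (by fun_prop) (fun v hv => by
      have := h.injective (Subtype.ext (sub_eq_zero.1 hv))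
      exact v.2.2 (by rw [← this]; rfl))
  have hsD : ∀ z ∈ Metric.sphere p (r/2), z ∈ D := fun z hz =>
    interior_subset (hrD (by
      rw [Metric.mem_sphere] at hz; rw [Metric.mem_ball]; linarith))
  have hsV : ∀ z (hz : z ∈ Metric.sphere p (r/2)), (h.symm ⟨z, hsD z hz⟩ : ℂ) ∈ V := by
    intro z hz
    refine ⟨(h.symm ⟨z, hsD z hz⟩).2, fun hh => ?_⟩
    have : h.symm ⟨z, hsD z hz⟩ = c := Subtype.ext hh
    have h2 : (⟨z, hsD z hz⟩ : D) = h c := by rw [← this]; simp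
    have h3 : z = p := congrArg Subtype.val h2
    rw [h3, Metric.mem_sphere, dist_self] at hz
    linarith
  classical
  refine aux_no_log p (r/2) (by linarith)
    (fun z => if hz : z ∈ Metric.sphere p (r/2) then l ⟨_, hsV z hz⟩ else 0) ?_ ?_
  · rw [continuousOn_iff_continuous_domRestrict]
    have : Continuous fun z : Metric.sphere p (r/2) => l ⟨_, hsV z z.2⟩ := by fun_prop
    convert this using 1
    funext z
    exact dif_pos z.2
  · intro z hz
    rw [dif_pos hz, hle]
    simp

/-- Interior points of the disk go to interior points. -/
lemma aux_ball (D : Set ℂ) (h : (Metric.closedBall (0:ℂ) 1) ≃ₜ D)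
    (a : Metric.closedBall (0:ℂ) 1) (ha : ‖(a : ℂ)‖ < 1) : (h a : ℂ) ∈ interior D := by
  by_contra hint
  set p : ℂ := (h a : ℂ) with hp
  have hDc : IsCompact D := isCompact_iff_compactSpace.2 h.compactSpace
  obtain ⟨s, hs, hsB⟩ : ∃ s > 0, Metric.sphere (a : ℂ) s ⊆ Metric.closedBall 0 1 := by
    refine ⟨1 - ‖(a:ℂ)‖, by linarith, fun z hz => ?_⟩
    rw [mem_sphere_iff_norm] at hz
    rw [mem_closedBall_zero_iff]
    have := norm_add_le (z - a) a
    rw [sub_add_cancel] at this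
    linarith
  -- extend the inverse
  obtain ⟨G, hG⟩ := ContinuousMap.exists_restrict_eq hDc.isClosed
    (⟨fun y : D => (h.symm y : ℂ) - a, by fun_prop⟩ : C(D, ℂ))
  have hGh : ∀ z, G (h z) = z - a := by
    intro z
    have := DFunLike.congr_fun hG (h z)
    simpa using this
  have hG0 : ∀ y ∈ D, G y = 0 → y = p := by
    intro y hy h0
    have h1 := hGh (h.symm ⟨y, hy⟩)
    rw [Homeomorph.apply_symm_apply, h0] at h1
    have h2 : h.symm ⟨y, hy⟩ = a := Subtype.ext (sub_eq_zero.1 h1.symm)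
    rw [hp, ← h2]; simp
  obtain ⟨ε, hε, hεG⟩ : ∃ ε > 0, ∀ y, dist y p < 2 * ε → ‖G y‖ < s := by
    obtain ⟨d, hd, hdG⟩ := Metric.continuous_iff.1 G.continuous p s hs
    refine ⟨d / 2, by linarith, fun y hy => ?_⟩
    have := hdG y (by linarith)
    rw [show G p = 0 by rw [hp, hGh]; simp] at this
    simpa using this
  obtain ⟨q, hqp, hqD⟩ : ∃ q, dist q p < ε ∧ q ∉ D := by
    by_contra! hcon
    exact hint (mem_interior_iff_mem_nhds.2 (Metric.mem_nhds_iff.2 ⟨ε, hε, fun q hq => hcon q hq⟩))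
  have hqp' : dist p q < ε := by rwa [dist_comm]
  -- lower bound
  obtain ⟨δ, hδ, hδs, hδG⟩ : ∃ δ > 0, δ ≤ s ∧ ∀ y ∈ D, ε ≤ dist y q → δ ≤ ‖G y‖ := by
    have hc : IsCompact (D ∩ {y | ε ≤ dist y q}) :=
      hDc.inter_right (isClosed_le continuous_const (by fun_prop))
    rcases (D ∩ {y | ε ≤ dist y q}).eq_empty_or_nonempty with he | hne
    · refine ⟨s, hs, le_rfl, fun y hy hy2 => ?_⟩
      have : y ∈ D ∩ {y | ε ≤ dist y q} := ⟨hy, hy2⟩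
      rw [he] at this; exact this.elim
    · obtain ⟨m, hm, hmin⟩ := hc.exists_isMinOn hne
        (f := fun y => ‖G y‖) (by fun_prop)
      refine ⟨min s ‖G m‖, lt_min hs (norm_pos_iff.2 fun h0 => ?_), min_le_left _ _,
        fun y hy hy2 => (min_le_right _ _).trans (hmin ⟨hy, hy2⟩)⟩
      have := hG0 m hm.1 h0
      have h2 : ε ≤ dist m q := hm.2
      rw [this] at h2
      linarith
  obtain ⟨P, hP, hPG, -⟩ := G.continuous.exists_contDiff_approx 1 (ε := fun _ => δ / 2)
    continuous_const (fun _ => by positivity)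
  -- generic shift
  obtain ⟨w, hw, hwP⟩ : ∃ w, ‖w‖ < δ / 2 ∧ ∀ y ∈ Metric.sphere q ε, P y ≠ w := by
    by_contra! hcon
    have h1 : MeasureTheory.volume (P '' Metric.sphere q ε) = 0 :=
      MeasureTheory.addHaar_image_eq_zero_of_differentiableOn_of_addHaar_eq_zero _
        (hP.differentiable (by simp)).differentiableOn
        (MeasureTheory.Measure.addHaar_sphere _ _ _)
    have h2 : Metric.ball (0:ℂ) (δ/2) ⊆ P '' Metric.sphere q ε := fun w hw => by
      obtain ⟨y, hy, hy2⟩ := hcon w (by simpa using hw)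
      exact ⟨y, hy, hy2⟩
    have h3 := MeasureTheory.measure_mono_null h2 h1
    exact (Metric.measure_ball_pos MeasureTheory.volume (0:ℂ) (half_pos hδ)).ne' h3
  have hPw : ∀ y, ‖P y - w - G y‖ < δ := by
    intro y
    have h1 := hPG y
    rw [dist_eq_norm] at h1
    calc ‖P y - w - G y‖ = ‖(P y - G y) - w‖ := by ring_nf
      _ ≤ ‖P y - G y‖ + ‖w‖ := norm_sub_le _ _
      _ < δ := by linarith
  let Φ : ℂ → ℂ := fun y => q + (max (ε / ‖y - q‖) 1 : ℝ) * (y - q)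
  have hyq : ∀ y ∈ D, 0 < ‖y - q‖ := fun y hy => norm_pos_iff.2 fun h0 => hqD (by
    rw [← sub_eq_zero.1 h0]; exact hy)
  have hΦc : ContinuousOn Φ D := by
    have : ContinuousOn (fun y : ℂ => ε / ‖y - q‖) D :=
      continuousOn_const.div (by fun_prop) fun y hy => (hyq y hy).ne'
    fun_prop
  have hΦ1 : ∀ y ∈ D, ε ≤ ‖y - q‖ → Φ y = y := by
    intro y hy hle
    have : max (ε / ‖y - q‖) 1 = 1 := max_eq_right ((div_le_one (hyq y hy)).2 hle)
    simp [Φ, this]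
  have hΦ2 : ∀ y ∈ D, ‖y - q‖ ≤ ε → Φ y ∈ Metric.sphere q ε := by
    intro y hy hle
    have h1 : max (ε / ‖y - q‖) 1 = ε / ‖y - q‖ := max_eq_left ((one_le_div (hyq y hy)).2 hle)
    have h2 := (hyq y hy).ne'
    simp only [Φ, h1, mem_sphere_iff_norm, add_sub_cancel_left, norm_mul, Complex.norm_real,
      Real.norm_eq_abs]
    rw [abs_of_nonneg (by positivity)]
    field_simp
  obtain ⟨l, hl, hle⟩ := aux_convex_log (Metric.closedBall 0 1) (convex_closedBall 0 1) ⟨a, a.2⟩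
    (fun z => P (Φ (h z)) - w)
    (by
      have h1 : Continuous fun z => Φ (h z) := hΦc.comp_continuous (by fun_prop) (fun z => (h z).2)
      exact (hP.continuous.comp h1).sub continuous_const)
    (fun z h0 => by
      rcases le_total ε ‖(h z : ℂ) - q‖ with hh | hh
      · rw [hΦ1 _ (h z).2 hh] at h0
        have h1 := hPw (h z)
        rw [h0, zero_sub, norm_neg] at h1
        have h2 := hδG (h z) (h z).2 (by rwa [dist_eq_norm])
        linarith
      · exact hwP _ (hΦ2 _ (h z).2 hh) (sub_eq_zero.1 h0))
  -- on the sphere the function is close to z - a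
  have hnear : ∀ z : Metric.closedBall (0:ℂ) 1, (z : ℂ) ∈ Metric.sphere (a : ℂ) s →
      Complex.exp (l z) / (z - a) ∈ Complex.slitPlane := by
    intro z hz
    rw [mem_sphere_iff_norm] at hz
    have hz0 : (z : ℂ) - a ≠ 0 := by rw [← norm_pos_iff, hz]; exact hs
    have hfar : ε ≤ ‖(h z : ℂ) - q‖ := by
      by_contra! hlt
      have h1 := hεG (h z) (by
        have := dist_triangle (h z : ℂ) q p
        rw [dist_eq_norm (h z : ℂ) q] at this
        linarith)
      rw [hGh, hz] at h1
      exact lt_irrefl _ h1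
    have h1 := hPw (h z)
    rw [hle, hΦ1 _ (h z).2 hfar]
    rw [hGh] at h1
    apply Complex.ball_one_subset_slitPlane
    rw [Metric.mem_ball, dist_eq_norm, div_sub_one hz0, norm_div, hz, div_lt_one hs]
    linarith
  classical
  refine aux_no_log a s hs (fun z => if hz : z ∈ Metric.sphere (a:ℂ) s then
    l ⟨z, hsB hz⟩ - Complex.log (Complex.exp (l ⟨z, hsB hz⟩) / (z - a)) else 0) ?_ ?_
  · rw [continuousOn_iff_continuous_domRestrict]
    have h0 : Continuous fun z : Metric.sphere (a:ℂ) s => l ⟨z, hsB z.2⟩ := by fun_prop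
    have : Continuous fun z : Metric.sphere (a:ℂ) s => l ⟨z, hsB z.2⟩ -
        Complex.log (Complex.exp (l ⟨z, hsB z.2⟩) / (z - a)) := by
      refine h0.sub (Continuous.clog ?_ fun z => hnear ⟨z, hsB z.2⟩ z.2)
      refine (Complex.continuous_exp.comp h0).div (by fun_prop) fun z hz => ?_
      have h2 := mem_sphere_iff_norm.1 z.2
      rw [hz, norm_zero] at h2
      linarith
    convert this using 1
    funext z
    exact dif_pos z.2
  · intro z hz
    have h2 := mem_sphere_iff_norm.1 hz
    have hz0 : (z : ℂ) - a ≠ 0 := by rw [← norm_pos_iff, h2]; exact hs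
    rw [dif_pos hz, Complex.exp_sub, Complex.exp_log (div_ne_zero (Complex.exp_ne_zero _) hz0)]
    have := Complex.exp_ne_zero (l ⟨z, hsB hz⟩)
    field_simp

lemma aux_frontier (D : Set ℂ) (h : (Metric.closedBall (0:ℂ) 1) ≃ₜ D) :
    frontier D = (fun z => (h z : ℂ)) '' {z | ‖(z : ℂ)‖ = 1} := by
  have hDc : IsCompact D := isCompact_iff_compactSpace.2 h.compactSpace
  rw [hDc.isClosed.frontier_eq]
  ext y
  constructor
  · rintro ⟨hy, hyi⟩
    refine ⟨h.symm ⟨y, hy⟩, ?_, by simp⟩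
    by_contra hne
    have h1 : ‖(h.symm ⟨y, hy⟩ : ℂ)‖ ≤ 1 := mem_closedBall_zero_iff.1 (h.symm ⟨y, hy⟩).2
    have := aux_ball D h _ (lt_of_le_of_ne h1 hne)
    simp at this
    exact hyi this
  · rintro ⟨z, hz, rfl⟩
    exact ⟨(h z).2, aux_sphere D h z hz⟩

/-- Zoretti-type theorem for Jordan domains: if `D ⊆ ℝ²` is homeomorphic to the
closed unit disk and `K ⊆ D` is compact, connected, and disjoint from `∂D`,
then all of `∂D` lies in a single connected component of `D \ K`, this is the
unique component whose closure meets `∂D`, and any two points of this component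
are joined by a path in `D \ K`. -/
theorem stmt17 (D : Set ℂ) (h : (Metric.closedBall (0:ℂ) 1) ≃ₜ D)
    (K : Set ℂ) (hK : IsCompact K) (hKc : IsConnected K) (hKD : K ⊆ D)
    (hKb : K ∩ frontier D = ∅) :
    (∀ x ∈ frontier D, ∀ x' ∈ frontier D, x' ∈ connectedComponentIn (D \ K) x) ∧
    (∀ x ∈ frontier D, ∀ y ∈ D \ K,
      (closure (connectedComponentIn (D \ K) y) ∩ frontier D).Nonempty →
      connectedComponentIn (D \ K) y = connectedComponentIn (D \ K) x) ∧
    (∀ x ∈ frontier D, ∀ x' ∈ connectedComponentIn (D \ K) x,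
      ∀ x'' ∈ connectedComponentIn (D \ K) x, JoinedIn (D \ K) x' x'') := by
  have hDc : IsCompact D := isCompact_iff_compactSpace.2 h.compactSpace
  have hfr : frontier D ⊆ D \ K := fun x hx =>
    ⟨hDc.isClosed.frontier_subset hx, fun hxK => by
      have : x ∈ K ∩ frontier D := ⟨hxK, hx⟩
      rw [hKb] at this; exact this⟩
  have hconn : IsPreconnected (frontier D) := by
    rw [aux_frontier D h]
    have h1 : IsPreconnected (Metric.sphere (0:ℂ) 1) :=
      isPreconnected_sphere (by rw [Complex.rank_real_complex]; norm_num) 0 1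
    have h2 : IsPreconnected {z : Metric.closedBall (0:ℂ) 1 | ‖(z : ℂ)‖ = 1} := by
      rw [← Topology.IsInducing.subtypeVal.isPreconnected_image]
      convert h1 using 1
      ext z
      simp +contextual [le_of_eq]
    exact h2.image _ (by fun_prop)
  have part1 : ∀ x ∈ frontier D, ∀ x' ∈ frontier D, x' ∈ connectedComponentIn (D \ K) x :=
    fun x hx x' hx' => hconn.subset_connectedComponentIn hx hfr hx'
  refine ⟨part1, ?_, ?_⟩
  · rintro x hx y hy ⟨c, hc, hcf⟩
    rw [connectedComponentIn_eq (part1 x hx c hcf)]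
    refine connectedComponentIn_eq ?_
    rw [connectedComponentIn_eq_image hy] at hc ⊢
    have : (⟨c, hfr hcf⟩ : ↥(D \ K)) ∈ closure (connectedComponent (⟨y, hy⟩ : ↥(D \ K))) :=
      closure_subtype.2 hc
    rw [isClosed_connectedComponent.closure_eq] at this
    exact ⟨_, this, rfl⟩
  · intro x hx x' hx' x'' hx''
    have l1 : LocallyPathConnectedSpace (Metric.closedBall (0:ℂ) 1) :=
      (convex_closedBall (0:ℂ) 1).locallyPathConnectedSpace
    have l2 : LocallyPathConnectedSpace D :=
      h.symm.isOpenEmbedding.locallyPathConnectedSpace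
    have l3 : LocallyPathConnectedSpace ↥(D \ K) := by
      have : Topology.IsOpenEmbedding (Set.inclusion (sdiff_subset : D \ K ⊆ D)) := by
        refine ⟨Topology.IsEmbedding.inclusion _, ?_⟩
        rw [Set.range_inclusion]
        have : {x : D | (x : ℂ) ∈ D \ K} = Subtype.val ⁻¹' Kᶜ := by ext x; simp
        rw [this]
        exact hK.isClosed.isOpen_compl.preimage continuous_subtype_val
      exact this.locallyPathConnectedSpace
    rw [connectedComponentIn_eq_image (hfr hx), ← pathComponent_eq_connectedComponent] at hx' hx''
    obtain ⟨u, hu, rfl⟩ := hx'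
    obtain ⟨v, hv, rfl⟩ := hx''
    rw [joinedIn_iff_joined u.2 v.2]
    exact (mem_pathComponent_iff.1 hu).symm.trans (mem_pathComponent_iff.1 hv)
end

section
/- For the closed unit disk 𝔻 ⊆ ℝ², any curve dividing 𝔻 into two regions of equal area has length at least 2; equivalently, the shortest area-bisecting curve in the unit disk is a diameter. -/
open Set MeasureTheory

def dt (w z : ℂ) : ℝ := w.re * z.re + w.im * z.im

lemma dt_cont (w : ℂ) : Continuous (dt w) := by unfold dt; fun_prop

lemma dt_add (w x y : ℂ) : dt w (x + y) = dt w x + dt w y := by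
  simp [dt]; ring
lemma dt_sub (w x y : ℂ) : dt w (x - y) = dt w x - dt w y := by
  simp [dt]; ring
lemma dt_smul (w x : ℂ) (t : ℝ) : dt w (t • x) = t * dt w x := by
  simp [dt]; ring
lemma dt_comm (w x : ℂ) : dt w x = dt x w := by simp [dt]; ring
lemma nsq (z : ℂ) : ‖z‖ ^ 2 = dt z z := by
  rw [← Complex.normSq_eq_norm_sq, Complex.normSq_apply, dt]
lemma dt_le (w z : ℂ) : dt w z ≤ ‖w‖ * ‖z‖ := by
  refine le_of_sq_le_sq ?_ (by positivity)
  rw [mul_pow, nsq, nsq]; simp only [dt]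
  nlinarith [sq_nonneg (w.re * z.im - w.im * z.re)]

lemma frame (e z : ℂ) (he : ‖e‖ = 1) : ‖z‖ ^ 2 = dt e z ^ 2 + dt (Complex.I * e) z ^ 2 := by
  have h := nsq e
  rw [he] at h
  rw [nsq]; simp [dt] at *
  linear_combination (z.re^2+z.im^2) * h

lemma area_rect (e : ℂ) (he : ‖e‖ = 1) (a b c d : ℝ) :
    volume {z : ℂ | dt e z ∈ Icc a b ∧ dt (Complex.I * e) z ∈ Icc c d}
      = ENNReal.ofReal (b - a) * ENNReal.ofReal (d - c) := by
  have hm : MeasurePreserving (fun z : ℂ => (starRingEnd ℂ e) * z) volume volume := by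
    let u : Circle := ⟨starRingEnd ℂ e, by simp [Submonoid.unitSphere, he]⟩
    exact (rotation u).measurePreserving
  have h2 := Complex.volume_preserving_equiv_real_prod.comp hm
  have h3 := h2.measure_preimage (s := Icc a b ×ˢ Icc c d)
    (measurableSet_Icc.prod measurableSet_Icc).nullMeasurableSet
  rw [Measure.volume_eq_prod, Measure.prod_prod, Real.volume_Icc, Real.volume_Icc] at h3
  rw [← h3]
  congr 1
  ext z
  simp [dt, Complex.measurableEquivRealProd]
  rw [add_comm c, add_comm d]
  tauto

lemma half (n : ℂ) (ε : ℝ) (hε : 0 < ε) (B : Set ℂ) (hBD : B ⊆ Metric.closedBall 0 1)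
    (hB : B ⊆ {z | ε ≤ dt n z}) (harea : volume B = ENNReal.ofReal (Real.pi / 2)) : False := by
  set P : Set ℂ := Metric.closedBall 0 1 ∩ {z | ε ≤ dt n z} with hP
  set Q : Set ℂ := Metric.ball 0 1 ∩ {z | |dt n z| < ε} with hQ
  have hPm : MeasurableSet P :=
    measurableSet_closedBall.inter (isClosed_le continuous_const (dt_cont n)).measurableSet
  have hQo : IsOpen Q := Metric.isOpen_ball.inter (isOpen_lt (dt_cont n).abs continuous_const)
  have hQp : 0 < volume Q := hQo.measure_pos _ ⟨0, by simp [hQ, dt, hε]⟩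
  have neg (z : ℂ) : dt n (-z) = - dt n z := by simp [dt]; ring
  have h1 : volume (P ∪ (-P) ∪ Q) = volume P + volume (-P) + volume Q := by
    rw [measure_union _ hQo.measurableSet, measure_union _ hPm.neg]
    · rw [Set.disjoint_left]
      rintro z hz hz'
      have a := hz.2
      have b := hz'.2
      simp only [mem_ofPred_eq, neg] at a b
      linarith
    · rw [Set.disjoint_left]
      rintro z (hz|hz) hz'
      · have a := hz.2
        have b := hz'.2
        simp only [mem_ofPred_eq, abs_lt] at a b
        linarith
      · have a := hz.2
        have b := hz'.2
        simp only [mem_ofPred_eq, neg, abs_lt] at a b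
        linarith
  have h2 : volume (P ∪ (-P) ∪ Q) ≤ ENNReal.ofReal Real.pi := by
    have : volume (Metric.closedBall (0:ℂ) 1) = ENNReal.ofReal Real.pi := by
      rw [Complex.volume_closedBall]; simp
      rw [← NNReal.coe_real_pi, ENNReal.ofReal_coe_nnreal]
    rw [← this]
    apply measure_mono
    rintro z ((hz|hz)|hz)
    · exact hz.1
    · simpa using hz.1
    · exact Metric.ball_subset_closedBall hz.1
  have h3 : ENNReal.ofReal (Real.pi / 2) ≤ volume P := by
    rw [← harea]; exact measure_mono (subset_inter hBD hB)
  rw [h1, Measure.measure_neg] at h2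
  have h4 : ENNReal.ofReal Real.pi < ENNReal.ofReal Real.pi + volume Q :=
    ENNReal.lt_add_right ENNReal.ofReal_ne_top hQp.ne'
  have h5 : ENNReal.ofReal Real.pi = ENNReal.ofReal (Real.pi / 2) + ENNReal.ofReal (Real.pi / 2) := by
    rw [← ENNReal.ofReal_add (by positivity) (by positivity)]; congr 1; ring
  refine absurd (h4.trans_le ?_) (lt_irrefl (ENNReal.ofReal Real.pi))
  refine le_trans ?_ h2
  rw [h5]
  gcongr

lemma poly_len (γ : ℝ → ℂ) (L : ℝ) (hL : 0 ≤ L)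
    (hlen : eVariationOn γ (Icc 0 1) = ENNReal.ofReal L)
    (a b c d : ℝ) (h0 : 0 ≤ a) (hab : a ≤ b) (hbc : b ≤ c) (hcd : c ≤ d) (h1 : d ≤ 1) :
    ‖γ b - γ a‖ + ‖γ c - γ b‖ + ‖γ d - γ c‖ ≤ L := by
  have e (x y : ℝ) (h : x ≤ y) : ENNReal.ofReal ‖γ y - γ x‖ ≤ eVariationOn γ (Icc x y) := by
    have := eVariationOn.edist_le γ (s := Icc x y) (x := y) (y := x) ⟨h, le_rfl⟩ ⟨le_rfl, h⟩
    rwa [edist_dist, dist_eq_norm] at this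
  have s1 := eVariationOn.Icc_add_Icc γ (s := univ) hab hbc trivial
  have s2 := eVariationOn.Icc_add_Icc γ (s := univ) (hab.trans hbc) hcd trivial
  simp only [univ_inter] at s1 s2
  have m : eVariationOn γ (Icc a d) ≤ ENNReal.ofReal L := by
    rw [← hlen]; exact eVariationOn.mono γ (Icc_subset_Icc h0 h1)
  rw [← ENNReal.ofReal_le_ofReal_iff hL, ENNReal.ofReal_add (by positivity) (by positivity),
    ENNReal.ofReal_add (by positivity) (by positivity)]
  refine le_trans ?_ m
  rw [← s2, ← s1]
  gcongr
  exacts [e _ _ hab, e _ _ hbc, e _ _ hcd]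

/-- far boundary points -/
lemma far_mid (γ : ℝ → ℂ) (L : ℝ) (hL2 : L < 2)
    (hp : ∀ a b c d : ℝ, 0 ≤ a → a ≤ b → b ≤ c → c ≤ d → d ≤ 1 →
      ‖γ b - γ a‖ + ‖γ c - γ b‖ + ‖γ d - γ c‖ ≤ L)
    (a b t : ℝ) (ha : 0 ≤ a) (hab : a ≤ b) (hb : b ≤ 1) (ht0 : 0 ≤ t) (ht1 : t ≤ 1)
    (na : ‖γ a‖ = 1) (nb : ‖γ b‖ = 1) (hd : 6/5 ≤ ‖γ a - γ b‖) :
    0 < dt (γ a + γ b) (γ t) := by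
  by_contra hneg
  push Not at hneg
  have qa := nsq (γ a)
  have qb := nsq (γ b)
  rw [na] at qa; rw [nb] at qb
  have hpq : ‖γ a - γ b‖ ^ 2 + ‖γ a + γ b‖ ^ 2 = 4 := by
    rw [nsq, nsq]; simp [dt] at *; linarith
  set c := ‖γ a - γ b‖
  set s := ‖γ a + γ b‖ with hs
  have hs0 : 0 ≤ s := norm_nonneg _
  have key : 4 ≤ 2 * c + s := by
    have hc2 : c ≤ 2 := by nlinarith
    by_contra hh
    push Not at hh
    nlinarith
  have dist_ge (p : ℂ) (hpn : dt (γ a + γ b) p = s ^ 2 / 2) : s / 2 ≤ ‖p - γ t‖ := by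
    have h1 := dt_le (γ a + γ b) (p - γ t)
    rw [dt_sub, hpn] at h1
    rcases hs0.eq_or_lt with h | h
    · rw [← h]; simp
    · rw [← hs] at h1
      have : s * (s / 2) ≤ s * ‖p - γ t‖ := by nlinarith
      exact le_of_mul_le_mul_left this h
  have pa : dt (γ a + γ b) (γ a) = s ^ 2 / 2 := by
    rw [hs, nsq]; simp [dt] at *; linarith
  have pb : dt (γ a + γ b) (γ b) = s ^ 2 / 2 := by
    rw [hs, nsq]; simp [dt] at *; linarith
  rcases le_total t a with h | h
  · have h1 := hp t a b b ht0 h hab le_rfl hb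
    have h2 := dist_ge _ pa
    rw [sub_self, norm_zero, norm_sub_rev (γ b)] at h1
    linarith
  rcases le_total b t with h' | h'
  · have h1 := hp a b t t ha hab h' le_rfl ht1
    have h2 := dist_ge _ pb
    rw [sub_self, norm_zero, norm_sub_rev (γ b), norm_sub_rev (γ t)] at h1
    linarith
  · have h1 := hp a t b b ha h h' le_rfl hb
    rw [sub_self, norm_zero] at h1
    have h2 : ‖γ t + γ a‖ ≤ ‖γ b - γ t‖ := by
      refine (sq_le_sq₀ (norm_nonneg _) (norm_nonneg _)).1 ?_
      rw [nsq, nsq]; simp [dt] at *; nlinarith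
    have h3 : ‖(2:ℂ) * γ a‖ ≤ ‖γ t - γ a‖ + ‖γ t + γ a‖ := by
      calc _ = ‖(γ t + γ a) - (γ t - γ a)‖ := by congr 1; ring
        _ ≤ _ := by
          rw [add_comm ‖γ t - γ a‖]
          exact norm_sub_le (γ t + γ a) (γ t - γ a)
    rw [norm_mul, na] at h3
    simp at h3
    linarith

lemma far_case (γ : ℝ → ℂ) (L : ℝ) (hL2 : L < 2) (K A B : Set ℂ)
    (hγ : ContinuousOn γ (Icc 0 1)) (him : γ '' Icc 0 1 = K)
    (hp : ∀ a b c d : ℝ, 0 ≤ a → a ≤ b → b ≤ c → c ≤ d → d ≤ 1 →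
      ‖γ b - γ a‖ + ‖γ c - γ b‖ + ‖γ d - γ c‖ ≤ L)
    (hAD : A ⊆ Metric.closedBall 0 1) (hBD : B ⊆ Metric.closedBall 0 1)
    (hsep : ∀ T : Set ℂ, IsPreconnected T → T ⊆ Metric.closedBall 0 1 → (∀ z ∈ T, z ∉ K) →
      ∀ x ∈ T, ∀ y ∈ T, x ∈ A → y ∈ B → False)
    (hareaA : volume A = ENNReal.ofReal (Real.pi / 2))
    (hareaB : volume B = ENNReal.ofReal (Real.pi / 2))
    (a b : ℝ) (ha : 0 ≤ a) (hab : a ≤ b) (hb : b ≤ 1)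
    (na : ‖γ a‖ = 1) (nb : ‖γ b‖ = 1) (hd : 6/5 ≤ ‖γ a - γ b‖) : False := by
  set n := γ a + γ b
  obtain ⟨t, ht, hmin⟩ := isCompact_Icc.exists_isMinOn (nonempty_Icc.2 zero_le_one)
    ((dt_cont n).comp_continuousOn hγ)
  have hpos : 0 < dt n (γ t) := far_mid γ L hL2 hp a b t ha hab hb ht.1 ht.2 na nb hd
  set ε := dt n (γ t)
  set T : Set ℂ := Metric.closedBall 0 1 ∩ {z | dt n z < ε} with hT
  have hTc : IsPreconnected T := by
    apply Convex.isPreconnected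
    apply (convex_closedBall _ _).inter
    apply convex_halfSpace_lt
    constructor
    · exact dt_add n
    · intro c x; exact dt_smul n x c
  have hTK : ∀ z ∈ T, z ∉ K := by
    rintro z hz hzK
    rw [← him] at hzK
    obtain ⟨r, hr, rfl⟩ := hzK
    have := hmin hr
    have h2 := hz.2
    simp only [mem_ofPred_eq, Function.comp] at this h2
    linarith
  by_cases h : ∃ x ∈ T, x ∈ A
  · obtain ⟨x, hx, hxA⟩ := h
    refine half n ε hpos B hBD ?_ hareaB
    intro y hy
    by_contra hy'
    exact hsep T hTc inter_subset_left hTK x hx y ⟨hBD hy, by simpa using hy'⟩ hxA hy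
  · refine half n ε hpos A hAD ?_ hareaA
    intro y hy
    by_contra hy'
    exact h ⟨y, ⟨hAD hy, by simpa using hy'⟩, hy⟩

lemma arith1 (d w h : ℝ) (hd : 0 ≤ d) (hw : 0 ≤ w) (hh : 0 ≤ h) (h1 : 2 * w ≤ 2 + d)
    (h2 : (2 * h) ^ 2 + d ^ 2 ≤ 4) : w * h ≤ 13 / 10 := by
  refine le_of_sq_le_sq ?_ (by norm_num)
  have e1 : (2 * w) ^ 2 ≤ (2 + d) ^ 2 := by gcongr
  have e2 : (2 * h) ^ 2 ≤ 4 - d ^ 2 := by linarith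
  have e3 : (2 * w) ^ 2 * (2 * h) ^ 2 ≤ (2 + d) ^ 2 * (4 - d ^ 2) := by gcongr
  have e4 : (2 + d) ^ 2 * (4 - d ^ 2) = 27 - (d - 1) ^ 2 * (d ^ 2 + 6 * d + 11) := by ring
  have e5 : 0 ≤ (d - 1) ^ 2 * (d ^ 2 + 6 * d + 11) := by positivity
  nlinarith

lemma refl3 (e v1 v2 v3 : ℂ) (he : ‖e‖ = 1) (σ τ : ℝ) (hσ : σ ^ 2 = 1) (hτ : τ ^ 2 = 1)
    (L : ℝ) (hL : ‖v1‖ + ‖v2‖ + ‖v3‖ ≤ L) :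
    (dt e v1 + σ * dt e v2 + dt e v3) ^ 2 +
    (dt (Complex.I * e) v1 + τ * dt (Complex.I * e) v2 + dt (Complex.I * e) v3) ^ 2 ≤ L ^ 2 := by
  set f := Complex.I * e with hf
  have n1 : ‖(⟨dt e v1, dt f v1⟩ : ℂ)‖ = ‖v1‖ := by
    rw [← sq_eq_sq₀ (norm_nonneg _) (norm_nonneg _), frame e v1 he, nsq]; simp [dt, f]; ring
  have n3 : ‖(⟨dt e v3, dt f v3⟩ : ℂ)‖ = ‖v3‖ := by
    rw [← sq_eq_sq₀ (norm_nonneg _) (norm_nonneg _), frame e v3 he, nsq]; simp [dt, f]; ring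
  have n2 : ‖(⟨σ * dt e v2, τ * dt f v2⟩ : ℂ)‖ = ‖v2‖ := by
    rw [← sq_eq_sq₀ (norm_nonneg _) (norm_nonneg _), frame e v2 he, nsq, ← hf]
    generalize dt e v2 = x
    generalize dt f v2 = y
    simp only [dt]
    linear_combination x ^ 2 * hσ + y ^ 2 * hτ
  have h := norm_add₃_le (a := (⟨dt e v1, dt f v1⟩ : ℂ)) (b := ⟨σ * dt e v2, τ * dt f v2⟩)
    (c := ⟨dt e v3, dt f v3⟩)
  rw [n1, n2, n3] at h
  have h' := h.trans hL
  have h'' := pow_le_pow_left₀ (norm_nonneg _) h' 2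
  refine le_trans (le_of_eq ?_) h''
  rw [nsq]
  generalize dt e v2 = x
  generalize dt f v2 = y
  generalize dt e v1 = x1
  generalize dt f v1 = y1
  generalize dt e v3 = x3
  generalize dt f v3 = y3
  simp [dt]; ring

lemma box (γ : ℝ → ℂ) (L : ℝ) (hL0 : 0 ≤ L) (hL2 : L < 2)
    (hγ : ContinuousOn γ (Icc 0 1))
    (hp : ∀ a b c d : ℝ, 0 ≤ a → a ≤ b → b ≤ c → c ≤ d → d ≤ 1 →
      ‖γ b - γ a‖ + ‖γ c - γ b‖ + ‖γ d - γ c‖ ≤ L) :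
    ∃ e : ℂ, ‖e‖ = 1 ∧ ∃ a b c d : ℝ, a ≤ b ∧ c ≤ d ∧ (b - a) * (d - c) ≤ 13 / 10 ∧
      ∀ t ∈ Icc (0:ℝ) 1, dt e (γ t) ∈ Icc a b ∧ dt (Complex.I * e) (γ t) ∈ Icc c d := by
  obtain ⟨e, he, D, hD0, hD⟩ : ∃ e : ℂ, ‖e‖ = 1 ∧ ∃ D : ℝ, 0 ≤ D ∧ γ 1 - γ 0 = D • e := by
    by_cases h : γ 1 - γ 0 = 0
    · exact ⟨1, by simp, 0, le_rfl, by simp [h]⟩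
    · have h' : ‖γ 1 - γ 0‖ ≠ 0 := norm_ne_zero_iff.2 h
      refine ⟨(‖γ 1 - γ 0‖⁻¹ : ℝ) • (γ 1 - γ 0), ?_, ‖γ 1 - γ 0‖, norm_nonneg _, ?_⟩
      · rw [norm_smul, norm_inv, norm_norm, inv_mul_cancel₀ h']
      · rw [smul_smul, mul_inv_cancel₀ h', one_smul]
  have hx : dt e (γ 1) - dt e (γ 0) = D := by
    rw [← dt_sub, hD, dt_smul, ← nsq, he]; ring
  have hy : dt (Complex.I * e) (γ 1) - dt (Complex.I * e) (γ 0) = 0 := by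
    rw [← dt_sub, hD, dt_smul]; simp [dt]; right; ring
  set f := Complex.I * e with hf
  have key (s t : ℝ) (hs : 0 ≤ s) (hst : s ≤ t) (ht : t ≤ 1) :
      (2 * (dt f (γ t) - dt f (γ s))) ^ 2 + D ^ 2 ≤ L ^ 2 ∧
      (2 * (dt e (γ t) - dt e (γ s)) - D) ^ 2 ≤ L ^ 2 := by
    have h := hp 0 s t 1 le_rfl hs hst ht le_rfl
    constructor
    · have := refl3 e _ _ _ he 1 (-1) (by norm_num) (by norm_num) L h
      refine le_trans (le_of_eq ?_) this
      simp only [dt_sub, ← hf]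
      rw [← hx]
      linear_combination (4 * (dt f (γ t) - dt f (γ s)) - (dt f (γ 1) - dt f (γ 0))) * hy
    · have := refl3 e _ _ _ he (-1) (-1) (by norm_num) (by norm_num) L h
      refine le_trans ?_ this
      refine le_trans (le_of_eq ?_) (le_add_of_nonneg_right (sq_nonneg _))
      simp only [dt_sub]
      rw [← hx]
      ring
  have key2 (s t : ℝ) (hs : s ∈ Icc (0:ℝ) 1) (ht : t ∈ Icc (0:ℝ) 1) :
      (2 * (dt f (γ t) - dt f (γ s))) ^ 2 + D ^ 2 ≤ 4 ∧
      2 * (dt e (γ t) - dt e (γ s)) ≤ 2 + D := by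
    have hL4 : L ^ 2 ≤ 4 := by nlinarith
    rcases le_total s t with h | h
    · obtain ⟨h1, h2⟩ := key s t hs.1 h ht.2
      refine ⟨by linarith, ?_⟩
      have := abs_le_of_sq_le_sq h2 hL0
      linarith [(abs_le.1 (abs_le_of_sq_le_sq' h2 hL0 |> abs_le.2)).2]
    · obtain ⟨h1, h2⟩ := key t s ht.1 h hs.2
      refine ⟨by nlinarith, ?_⟩
      linarith [(abs_le_of_sq_le_sq' h2 hL0).1]
  have ne : (Icc (0:ℝ) 1).Nonempty := nonempty_Icc.2 zero_le_one
  have ce := (dt_cont e).comp_continuousOn hγ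
  have cf := (dt_cont f).comp_continuousOn hγ
  obtain ⟨t1, ht1, m1⟩ := isCompact_Icc.exists_isMinOn ne ce
  obtain ⟨t2, ht2, m2⟩ := isCompact_Icc.exists_isMaxOn ne ce
  obtain ⟨t3, ht3, m3⟩ := isCompact_Icc.exists_isMinOn ne cf
  obtain ⟨t4, ht4, m4⟩ := isCompact_Icc.exists_isMaxOn ne cf
  have w : dt e (γ t1) ≤ dt e (γ t2) := m1 ht2
  have h : dt f (γ t3) ≤ dt f (γ t4) := m3 ht4
  exact ⟨e, he, dt e (γ t1), dt e (γ t2), dt f (γ t3), dt f (γ t4), w, h,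
    arith1 D _ _ hD0 (by linarith) (by linarith) (key2 t1 t2 ht1 ht2).2 (key2 t3 t4 ht3 ht4).1,
    fun t ht => ⟨⟨m1 ht, m2 ht⟩, ⟨m3 ht, m4 ht⟩⟩⟩

lemma gram (p q r : ℂ) (hp : ‖p‖ = 1) (hq : ‖q‖ = 1) (hr : ‖r‖ = 1) :
    1 + 2 * dt p q * dt r p * dt r q - dt p q ^ 2 - dt r p ^ 2 - dt r q ^ 2 = 0 := by
  have h1 := nsq p
  have h2 := nsq q
  have h3 := nsq r
  rw [hp] at h1; rw [hq] at h2; rw [hr] at h3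
  have id : dt p p * dt q q * dt r r + 2 * dt p q * dt r p * dt r q - dt p q ^ 2 * dt r r
    - dt r p ^ 2 * dt q q - dt r q ^ 2 * dt p p = 0 := by
    simp only [dt]; ring
  rw [← h1, ← h2, ← h3] at id
  linarith

lemma arith2 (k a b : ℝ) (hk : 0 < k) (hk1 : k ≤ 1) (ha : k ≤ a) (hb : k ≤ b)
    (hg : 1 + 2 * k * a * b - k ^ 2 - a ^ 2 - b ^ 2 = 0) : 1 + k ≤ a + b := by
  by_contra h
  push Not at h
  have id : (a + b) ^ 2 * (1 - k) + (a - b) ^ 2 * (1 + k) = 2 * (1 - k ^ 2) := by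
    linear_combination -2 * hg
  have h1 : (a + b) ^ 2 < (1 + k) ^ 2 := by
    apply pow_lt_pow_left₀ h (by linarith) (by norm_num)
  have h2 : (1 - k) ^ 2 ≤ (a - b) ^ 2 := by
    have : (1 - k) ^ 2 * (1 + k) ≤ (a - b) ^ 2 * (1 + k) := by nlinarith
    exact le_of_mul_le_mul_right this (by linarith)
  have h3 := sq_le_sq.1 h2
  rw [abs_of_nonneg (by linarith)] at h3
  rcases le_abs.1 h3 with h4 | h4 <;> linarith

lemma cap (K : Set ℂ) (hK : IsCompact K)
    (hnear : ∀ p ∈ K, ∀ q ∈ K, ‖p‖ = 1 → ‖q‖ = 1 → ‖p - q‖ < 6 / 5) :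
    ∃ (u : ℂ) (s c : ℝ), ‖u‖ = 1 ∧ 4 / 5 ≤ s ∧ s ≤ 1 ∧ 0 ≤ c ∧ c ^ 2 + s ^ 2 = 1 ∧
      ∀ r ∈ K, ‖r‖ = 1 → s ≤ dt u r := by
  set S := K ∩ {z | ‖z‖ = 1} with hS
  have hSc : IsCompact S := hK.inter_right (isClosed_eq continuous_norm continuous_const)
  rcases S.eq_empty_or_nonempty with h | h
  · refine ⟨1, 1, 0, by simp, by norm_num, le_rfl, le_rfl, by norm_num, ?_⟩
    intro r hr hr1
    have : r ∈ S := ⟨hr, hr1⟩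
    rw [h] at this
    exact this.elim
  obtain ⟨⟨p, q⟩, ⟨hp, hq⟩, hm⟩ := (hSc.prod hSc).exists_isMinOn (h.prod h)
    (f := fun x : ℂ × ℂ => dt x.1 x.2) (by unfold dt; fun_prop)
  have np : ‖p‖ = 1 := hp.2
  have nq : ‖q‖ = 1 := hq.2
  have h1 := nsq p
  have h2 := nsq q
  rw [np] at h1; rw [nq] at h2
  have hd := hnear p hp.1 q hq.1 np nq
  have hk : 7 / 25 < dt p q := by
    have h3 : ‖p - q‖ ^ 2 = 2 - 2 * dt p q := by
      rw [nsq]; simp only [dt, Complex.sub_re, Complex.sub_im] at *; linarith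
    nlinarith [norm_nonneg (p - q)]
  have hk1 : dt p q ≤ 1 := by have := dt_le p q; rw [np, nq] at this; linarith
  have hn : ‖p + q‖ ^ 2 = 2 + 2 * dt p q := by
    rw [nsq]; simp only [dt, Complex.add_re, Complex.add_im] at *; linarith
  set N := ‖p + q‖ with hN
  have hN0 : 0 ≤ N := norm_nonneg _
  have hN1 : 8 / 5 ≤ N := by nlinarith
  have hN2 : N ≤ 2 := by nlinarith
  refine ⟨N⁻¹ • (p + q), N / 2, Real.sqrt (1 - (N / 2) ^ 2), ?_, by linarith, by linarith,
    Real.sqrt_nonneg _, ?_, ?_⟩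
  · rw [norm_smul, ← hN, norm_inv, Real.norm_of_nonneg hN0]
    exact inv_mul_cancel₀ (by linarith)
  · rw [Real.sq_sqrt (by nlinarith)]; ring
  · intro r hr nr
    have ha : dt p q ≤ dt r p := hm (show (r, p) ∈ S ×ˢ S from ⟨⟨hr, nr⟩, hp⟩)
    have hb : dt p q ≤ dt r q := hm (show (r, q) ∈ S ×ˢ S from ⟨⟨hr, nr⟩, hq⟩)
    have := arith2 _ _ _ (by linarith) hk1 ha hb (gram p q r np nq nr)
    rw [dt_comm, dt_smul, dt_add, inv_mul_eq_div, le_div_iff₀ (by linarith)]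
    nlinarith

lemma walk (n u z : ℂ) (hn : ‖n‖ = 1) (hz : ‖z‖ ≤ 1) :
    ∃ w : ℂ, ‖w‖ = 1 ∧ dt n w = dt n z ∧ dt u w ≤ dt u z := by
  obtain ⟨v, hv, hnv, huv⟩ : ∃ v : ℂ, ‖v‖ = 1 ∧ dt n v = 0 ∧ dt u v ≤ 0 := by
    have h0 : dt n (Complex.I * n) = 0 := by simp [dt]; ring
    rcases le_total (dt u (Complex.I * n)) 0 with h | h
    · exact ⟨Complex.I * n, by simp [hn], h0, h⟩
    · refine ⟨(-1 : ℝ) • (Complex.I * n), by simp [hn], ?_, ?_⟩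
      · rw [dt_smul, h0]; simp
      · rw [dt_smul]; linarith
  have hc : ContinuousOn (fun t : ℝ => ‖z + t • v‖) (Icc 0 2) := by fun_prop
  have hi := intermediate_value_Icc (by norm_num : (0:ℝ) ≤ 2) hc
  have : (1:ℝ) ∈ Icc (‖z + (0:ℝ) • v‖) (‖z + (2:ℝ) • v‖) := by
    refine ⟨by simpa using hz, ?_⟩
    have := norm_sub_le (z + (2:ℝ) • v) z
    rw [add_sub_cancel_left, norm_smul, hv] at this
    norm_num at this
    norm_num
    linarith
  obtain ⟨t, ht, h⟩ := hi this
  refine ⟨z + t • v, h, ?_, ?_⟩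
  · rw [dt_add, dt_smul, hnv]; ring
  · rw [dt_add, dt_smul]; nlinarith [ht.1]

lemma arc_conn (u : ℂ) (hu : ‖u‖ = 1) (s : ℝ) (hs : 0 < s) (hs1 : s ≤ 1) :
    IsPreconnected {w : ℂ | ‖w‖ = 1 ∧ dt u w < s} := by
  set f := Complex.I * u with hf
  have huu : dt u u = 1 := by rw [← nsq, hu]; norm_num
  have huf : dt u f = 0 := by simp [dt, f]; ring
  have hfu : dt f u = 0 := by rw [dt_comm, huf]
  have hff : dt f f = 1 := by rw [← nsq]; simp [f, hu]
  let g (σ : ℝ) (t : ℝ) : ℂ := t • u + (σ * Real.sqrt (1 - t ^ 2)) • f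
  have gc (σ : ℝ) : Continuous (g σ) := by
    simp only [g]
    fun_prop
  have key : {w : ℂ | ‖w‖ = 1 ∧ dt u w < s} = g 1 '' Ico (-1) s ∪ g (-1) '' Ico (-1) s := by
    apply Subset.antisymm
    · rintro w ⟨hw, hws⟩
      have fr := frame u w hu
      rw [hw, ← hf] at fr
      have hge : -1 ≤ dt u w := by nlinarith [sq_nonneg (dt f w)]
      have rep : w = dt u w • u + dt f w • f := by
        have e := huu
        simp only [dt] at e
        apply Complex.ext <;> simp [dt, f]
        · linear_combination (-w.re) * e
        · linear_combination (-w.im) * e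
      have hsq : Real.sqrt (1 - dt u w ^ 2) = |dt f w| := by
        rw [← Real.sqrt_sq_eq_abs]; congr 1; linarith
      rcases le_total 0 (dt f w) with h | h
      · left
        refine ⟨dt u w, ⟨hge, hws⟩, ?_⟩
        simp only [g]
        rw [hsq, abs_of_nonneg h, one_mul, ← rep]
      · right
        refine ⟨dt u w, ⟨hge, hws⟩, ?_⟩
        simp only [g]
        rw [hsq, abs_of_nonpos h, neg_mul_neg, one_mul, ← rep]
    · have aux (σ : ℝ) (hσ : σ ^ 2 = 1) (t : ℝ) (ht : t ∈ Ico (-1) s) :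
          g σ t ∈ {w : ℂ | ‖w‖ = 1 ∧ dt u w < s} := by
        have h1 : dt u (g σ t) = t := by simp only [g, dt_add, dt_smul, huu, huf]; ring
        have h2 : dt f (g σ t) = σ * Real.sqrt (1 - t ^ 2) := by
          simp only [g, dt_add, dt_smul, hfu, hff]; ring
        refine ⟨?_, by rw [h1]; exact ht.2⟩
        have fr := frame u (g σ t) hu
        rw [← hf, h1, h2, mul_pow, hσ, Real.sq_sqrt (by nlinarith [ht.1, ht.2])] at fr
        have : ‖g σ t‖ ^ 2 = 1 := by linarith
        nlinarith [norm_nonneg (g σ t)]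
      rintro w (⟨t, ht, rfl⟩ | ⟨t, ht, rfl⟩)
      · exact aux 1 (by norm_num) t ht
      · exact aux (-1) (by norm_num) t ht
  rw [key]
  have m : (-1 : ℝ) ∈ Ico (-1) s := ⟨le_rfl, by linarith⟩
  refine IsPreconnected.union (g 1 (-1)) ⟨-1, m, rfl⟩ ⟨-1, m, by simp [g]⟩ ?_ ?_
  · exact isPreconnected_Ico.image _ (gc 1).continuousOn
  · exact isPreconnected_Ico.image _ (gc (-1)).continuousOn

/-- if the arc is in `A` then `B` is too small -/
lemma near_aux (K A B R : Set ℂ) (u e : ℂ) (s c a₁ b₁ c₁ d₁ : ℝ)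
    (hBD : B ⊆ Metric.closedBall 0 1)
    (hsep : ∀ T : Set ℂ, IsPreconnected T → T ⊆ Metric.closedBall 0 1 → (∀ z ∈ T, z ∉ K) →
      ∀ x ∈ T, ∀ y ∈ T, x ∈ A → y ∈ B → False)
    (hareaB : volume B = ENNReal.ofReal (Real.pi / 2))
    (hu : ‖u‖ = 1) (he : ‖e‖ = 1) (hs : 4 / 5 ≤ s) (hs1 : s ≤ 1) (hc : 0 ≤ c)
    (hcs : c ^ 2 + s ^ 2 = 1) (hab : a₁ ≤ b₁) (hcd : c₁ ≤ d₁)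
    (hbox : (b₁ - a₁) * (d₁ - c₁) ≤ 13 / 10)
    (hR : R = {z : ℂ | dt e z ∈ Icc a₁ b₁ ∧ dt (Complex.I * e) z ∈ Icc c₁ d₁})
    (hKR : K ⊆ R) (hΓ : {w : ℂ | ‖w‖ = 1 ∧ dt u w < s} ⊆ A) : False := by
  set C : Set ℂ := {z : ℂ | dt u z ∈ Icc s 1 ∧ dt (Complex.I * u) z ∈ Icc (-c) c} with hC
  have walk' (n z : ℂ) (hn : ‖n‖ = 1) (hz : z ∈ B) (hzs : dt u z < s)
      (hav : ∀ w ∈ K, dt n w ≠ dt n z) : False := by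
    have hz1 : ‖z‖ ≤ 1 := by simpa using hBD hz
    obtain ⟨w, hw, hwn, hwu⟩ := walk n u z hn hz1
    refine hsep (segment ℝ z w) (convex_segment z w).isPreconnected
      ((convex_closedBall _ _).segment_subset (hBD hz) (by simp [hw])) ?_ w
      (right_mem_segment ℝ z w) z (left_mem_segment ℝ z w) (hΓ ⟨hw, by linarith⟩) hz
    rintro y ⟨α, β, _, _, hαβ, rfl⟩ hyK
    apply hav _ hyK
    rw [dt_add, dt_smul, dt_smul, hwn, ← add_mul, hαβ, one_mul]
  have hsub : B ⊆ R ∪ C := by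
    intro z hz
    by_contra hno
    rw [mem_union, not_or] at hno
    obtain ⟨hzR, hzC⟩ := hno
    have hz1 : ‖z‖ ≤ 1 := by simpa using hBD hz
    have hzs : dt u z < s := by
      by_contra hh
      push Not at hh
      apply hzC
      have fr := frame u z hu
      have hle : ‖z‖ ^ 2 ≤ 1 := by nlinarith [norm_nonneg z]
      refine ⟨⟨hh, by have := dt_le u z; rw [hu] at this; linarith⟩, ?_⟩
      exact abs_le_of_sq_le_sq' (by nlinarith) hc
    rw [hR] at hzR
    by_cases h1 : dt e z ∈ Icc a₁ b₁
    · have h2 : dt (Complex.I * e) z ∉ Icc c₁ d₁ := fun h => hzR ⟨h1, h⟩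
      refine walk' (Complex.I * e) z (by simp [he]) hz hzs ?_
      intro w hw heq
      have := hKR hw
      rw [hR] at this
      exact h2 (heq ▸ this.2)
    · refine walk' e z he hz hzs ?_
      intro w hw heq
      have := hKR hw
      rw [hR] at this
      exact h1 (heq ▸ this.1)
  have hv := (measure_mono (μ := volume) hsub).trans (measure_union_le R C)
  rw [hareaB, hR, hC, area_rect e he, area_rect u hu, ← ENNReal.ofReal_mul (by linarith),
    ← ENNReal.ofReal_mul (by linarith), ← ENNReal.ofReal_add
      (mul_nonneg (by linarith) (by linarith)) (mul_nonneg (by linarith) (by linarith)),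
    ENNReal.ofReal_le_ofReal_iff (add_nonneg
      (mul_nonneg (by linarith) (by linarith)) (mul_nonneg (by linarith) (by linarith)))] at hv
  have hc3 : c ≤ 3 / 5 := by nlinarith
  have : (1 - s) * (c - -c) ≤ 1 / 5 * (6 / 5) := by
    apply mul_le_mul <;> linarith
  have := Real.pi_gt_d2
  linarith

/-- Any rectifiable curve in the closed unit disk whose complement splits into
two disjoint relatively open pieces of equal area `π/2` has length at least
`2` (the shortest area-bisecting curve of the disk is a diameter). -/
theorem stmt19 (K A B : Set ℂ) (L : ℝ) (γ : ℝ → ℂ)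
    (hγ : ContinuousOn γ (Icc 0 1)) (him : γ '' Icc 0 1 = K)
    (hKD : K ⊆ Metric.closedBall (0:ℂ) 1)
    (hlen : eVariationOn γ (Icc 0 1) = ENNReal.ofReal L) (hL : 0 ≤ L)
    (hA : ∃ U : Set ℂ, IsOpen U ∧ A = U ∩ (Metric.closedBall (0:ℂ) 1 \ K))
    (hB : ∃ V : Set ℂ, IsOpen V ∧ B = V ∩ (Metric.closedBall (0:ℂ) 1 \ K))
    (hdisj : Disjoint A B) (hunion : A ∪ B = Metric.closedBall (0:ℂ) 1 \ K)
    (hareaA : volume A = ENNReal.ofReal (Real.pi / 2))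
    (hareaB : volume B = ENNReal.ofReal (Real.pi / 2)) :
    2 ≤ L := by
  by_contra hL2
  push Not at hL2
  have hp := poly_len γ L hL hlen
  have hAD : A ⊆ Metric.closedBall 0 1 := fun z hz =>
    ((hunion ▸ mem_union_left B hz : z ∈ Metric.closedBall (0:ℂ) 1 \ K)).1
  have hBD : B ⊆ Metric.closedBall 0 1 := fun z hz =>
    ((hunion ▸ mem_union_right A hz : z ∈ Metric.closedBall (0:ℂ) 1 \ K)).1
  have hsep : ∀ T : Set ℂ, IsPreconnected T → T ⊆ Metric.closedBall 0 1 → (∀ z ∈ T, z ∉ K) →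
      ∀ x ∈ T, ∀ y ∈ T, x ∈ A → y ∈ B → False := by
    intro T hT hTD hTK x hx y hy hxA hyB
    obtain ⟨U, hU, hAU⟩ := hA
    obtain ⟨V, hV, hBV⟩ := hB
    have hsub : T ⊆ U ∪ V := by
      intro z hz
      have : z ∈ A ∪ B := by rw [hunion]; exact ⟨hTD hz, hTK z hz⟩
      rcases this with h | h
      · rw [hAU] at h; exact Or.inl h.1
      · rw [hBV] at h; exact Or.inr h.1
    rw [hAU] at hxA
    rw [hBV] at hyB
    obtain ⟨z, hz, hzU, hzV⟩ := hT U V hU hV hsub ⟨x, hx, hxA.1⟩ ⟨y, hy, hyB.1⟩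
    have h1 : z ∈ A := by rw [hAU]; exact ⟨hzU, hTD hz, hTK z hz⟩
    have h2 : z ∈ B := by rw [hBV]; exact ⟨hzV, hTD hz, hTK z hz⟩
    exact Set.disjoint_left.1 hdisj h1 h2
  have hK : IsCompact K := him ▸ isCompact_Icc.image_of_continuousOn hγ
  have hnear : ∀ p ∈ K, ∀ q ∈ K, ‖p‖ = 1 → ‖q‖ = 1 → ‖p - q‖ < 6 / 5 := by
    intro p hpK q hqK np nq
    by_contra hd
    push Not at hd
    rw [← him] at hpK hqK
    obtain ⟨a, ha, rfl⟩ := hpK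
    obtain ⟨b, hb, rfl⟩ := hqK
    rcases le_total a b with h | h
    · exact far_case γ L hL2 K A B hγ him hp hAD hBD hsep hareaA hareaB a b ha.1 h hb.2 np nq hd
    · rw [norm_sub_rev] at hd
      exact far_case γ L hL2 K A B hγ him hp hAD hBD hsep hareaA hareaB b a hb.1 h ha.2 nq np hd
  obtain ⟨u, s, c, hu, hs, hs1, hc, hcs, hcap⟩ := cap K hK hnear
  obtain ⟨e, he, a₁, b₁, c₁, d₁, hab, hcd, hbox, hmem⟩ := box γ L hL hL2 hγ hp
  have hKR : K ⊆ {z : ℂ | dt e z ∈ Icc a₁ b₁ ∧ dt (Complex.I * e) z ∈ Icc c₁ d₁} := by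
    rw [← him]
    rintro _ ⟨t, ht, rfl⟩
    exact hmem t ht
  have hconn := arc_conn u hu s (by linarith) hs1
  have hΓD : {w : ℂ | ‖w‖ = 1 ∧ dt u w < s} ⊆ Metric.closedBall 0 1 := by
    rintro w ⟨hw, _⟩
    simp [hw]
  have hΓK : ∀ z ∈ {w : ℂ | ‖w‖ = 1 ∧ dt u w < s}, z ∉ K := by
    rintro w ⟨hw, hws⟩ hwK
    linarith [hcap w hwK hw]
  have hAB : ∀ z ∈ {w : ℂ | ‖w‖ = 1 ∧ dt u w < s}, z ∈ A ∪ B := by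
    intro z hz
    rw [hunion]
    exact ⟨hΓD hz, hΓK z hz⟩
  by_cases h : ∃ x ∈ {w : ℂ | ‖w‖ = 1 ∧ dt u w < s}, x ∈ B
  · obtain ⟨x, hx, hxB⟩ := h
    refine near_aux K B A _ u e s c a₁ b₁ c₁ d₁ hAD ?_ hareaA hu he hs hs1 hc hcs hab hcd hbox
      rfl hKR ?_
    · intro T h1 h2 h3 x hx y hy hxB hyA
      exact hsep T h1 h2 h3 y hy x hx hyA hxB
    · intro z hz
      rcases hAB z hz with h | h
      · exact (hsep _ hconn hΓD hΓK z hz x hx h hxB).elim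
      · exact h
  · refine near_aux K A B _ u e s c a₁ b₁ c₁ d₁ hBD hsep hareaB hu he hs hs1 hc hcs hab hcd hbox
      rfl hKR ?_
    intro z hz
    rcases hAB z hz with h' | h'
    · exact h'
    · exact (h ⟨z, hz, h'⟩).elim
end
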